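/- Let d be an odd prime and for j, j' ∈ ℤ/dℤ define S^{(j,j')} = Σ_{k,k' ∈ ℤ/dℤ} ⟨φ_k^{(j)}, φ_{k'}^{(j')}⟩. If j = j', then S^{(j,j')} = d. If j ≠ j', then S^{(j,j')} = c_d·√d·((j'−j) | d). -/

import Mathlib

open Finset Complex

/-- `ω^a` for `a : ZMod d`, where `ω = exp(2πi/d)`; well defined since `ω^d = 1`. -/
noncomputable def mubOmega (d : ℕ) (a : ZMod d) : ℂ :=
  Complex.exp (2 * Real.pi * Complex.I * (a.val : ℂ) / d)

/-- The mutually unbiased basis vectors `φ_k^{(j)} ∈ ℂ^{ℤ/dℤ}` with entries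
`(φ_k^{(j)})_ℓ = (1/√d)·ω^{−kℓ + jℓ² + k²}`. -/
noncomputable def mubPhi (d : ℕ) (j k : ZMod d) : ZMod d → ℂ :=
  fun ℓ => (1 / (Real.sqrt d : ℂ)) * mubOmega d (-k * ℓ + j * ℓ ^ 2 + k ^ 2)

/-- The inner product `⟨u, v⟩ = Σ_ℓ conj(u_ℓ)·v_ℓ` on `ℂ^{ℤ/dℤ}`,
conjugate-linear in the first argument. -/
noncomputable def mubInner (d : ℕ) [NeZero d] (u v : ZMod d → ℂ) : ℂ :=
  ∑ ℓ : ZMod d, (starRingEnd ℂ) (u ℓ) * v ℓ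

/-- `S^{(j,j')} = Σ_{k,k'} ⟨φ_k^{(j)}, φ_{k'}^{(j')}⟩`. -/
noncomputable def mubS (d : ℕ) [NeZero d] (j j' : ZMod d) : ℂ :=
  ∑ k : ZMod d, ∑ k' : ZMod d, mubInner d (mubPhi d j k) (mubPhi d j' k')

/-- `c_d = 1` if `d ≡ 1 (mod 4)` and `c_d = i` if `d ≡ 3 (mod 4)`. -/
noncomputable def mubC (d : ℕ) : ℂ :=
  if d % 4 = 1 then 1 else Complex.I

/-- The Gaussian binomial coefficient, evaluated at `q`. -/
def qBinom {R : Type*} [CommRing R] (q : R) : ℕ → ℕ → R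
  | _, 0 => 1
  | 0, _ + 1 => 0
  | n + 1, k + 1 => qBinom q n k + q ^ (k + 1) * qBinom q n (k + 1)

section qBinom

variable {R : Type*} [CommRing R] (q : R)

@[simp]
lemma qBinom_zero_right (n : ℕ) : qBinom q n 0 = 1 := by
  cases n <;> rfl

@[simp]
lemma qBinom_zero_succ (k : ℕ) : qBinom q 0 (k + 1) = 0 := rfl

lemma qBinom_succ_succ (n k : ℕ) :
    qBinom q (n + 1) (k + 1) = qBinom q n k + q ^ (k + 1) * qBinom q n (k + 1) := rfl

lemma qBinom_eq_zero_of_lt {n k : ℕ} (h : n < k) : qBinom q n k = 0 := by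
  induction n generalizing k with
  | zero =>
    obtain ⟨k, rfl⟩ := Nat.exists_eq_succ_of_ne_zero h.ne'
    rfl
  | succ n ih =>
    obtain ⟨k, rfl⟩ := Nat.exists_eq_succ_of_ne_zero (Nat.ne_zero_of_lt h)
    rw [Nat.succ_eq_add_one, qBinom_succ_succ, ih (by omega), ih (by omega)]
    ring

lemma one_sub_pow_mul_qBinom_succ_succ (n k : ℕ) :
    (1 - q ^ (k + 1)) * qBinom q (n + 1) (k + 1) = (1 - q ^ (n + 1)) * qBinom q n k := by
  induction n generalizing k with
  | zero => cases k <;> simp [qBinom_succ_succ]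
  | succ n ih =>
    cases k with
    | zero =>
      have h := ih 0
      simp only [qBinom_zero_right] at h
      rw [qBinom_succ_succ, qBinom_zero_right]
      linear_combination q * h
    | succ k =>
      rw [qBinom_succ_succ q (n + 1) (k + 1)]
      linear_combination q ^ (k + 2) * ih (k + 1) + q * ih k -
        q * (1 - q ^ (n + 1)) * qBinom_succ_succ q n k

lemma sum_neg_one_pow_mul_qBinom_add_two (n : ℕ) :
    ∑ k ∈ range (n + 3), (-1) ^ k * qBinom q (n + 2) k =
      (1 - q ^ (n + 1)) * ∑ k ∈ range (n + 1), (-1) ^ k * qBinom q n k := by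
  have h₁ : ∑ k ∈ range (n + 2), (-1) ^ k * qBinom q (n + 1) k =
      1 - ∑ k ∈ range (n + 2), (-1) ^ k * qBinom q (n + 1) (k + 1) := by
    rw [sum_range_succ', sum_range_succ _ (n + 1), qBinom_eq_zero_of_lt q (Nat.lt_succ_self _)]
    simp only [pow_succ, mul_neg_one, neg_mul, sum_neg_distrib, pow_zero, qBinom_zero_right]
    ring
  have h₂ : (1 - q ^ (n + 1)) * ∑ k ∈ range (n + 1), (-1) ^ k * qBinom q n k =
      ∑ k ∈ range (n + 2), (-1) ^ k * ((1 - q ^ (k + 1)) * qBinom q (n + 1) (k + 1)) := by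
    rw [sum_range_succ _ (n + 1), qBinom_eq_zero_of_lt q (Nat.lt_succ_self _), mul_sum]
    simp only [one_sub_pow_mul_qBinom_succ_succ, mul_zero, add_zero]
    exact sum_congr rfl fun k _ ↦ by ring
  rw [h₂, sum_range_succ']
  simp only [qBinom_succ_succ q (n + 1), pow_zero, qBinom_zero_right, one_mul]
  have h₃ : ∑ k ∈ range (n + 2), (-1) ^ (k + 1) *
        (qBinom q (n + 1) k + q ^ (k + 1) * qBinom q (n + 1) (k + 1)) =
      -(∑ k ∈ range (n + 2), (-1) ^ k * qBinom q (n + 1) k) -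
        ∑ k ∈ range (n + 2), (-1) ^ k * (q ^ (k + 1) * qBinom q (n + 1) (k + 1)) := by
    rw [← sum_neg_distrib, ← sum_sub_distrib]
    exact sum_congr rfl fun k _ ↦ by ring
  rw [h₃, h₁]
  simp only [sub_mul, one_mul, mul_sub, sum_sub_distrib]
  ring

/-- Gauss's product formula for the alternating sum of Gaussian binomial coefficients. -/
lemma sum_neg_one_pow_mul_qBinom_two_mul (m : ℕ) :
    ∑ k ∈ range (2 * m + 1), (-1) ^ k * qBinom q (2 * m) k =
      ∏ i ∈ range m, (1 - q ^ (2 * i + 1)) := by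
  induction m with
  | zero => simp
  | succ m ih =>
    rw [prod_range_succ, ← ih, mul_comm _ (1 - _)]
    exact sum_neg_one_pow_mul_qBinom_add_two q (2 * m)

lemma IsPrimitiveRoot.pow_mul_qBinom [IsDomain R] {q : R} {n : ℕ}
    (hq : IsPrimitiveRoot q (n + 1)) {z : R} (hz : z ^ 2 = q) {k : ℕ} (hk : k ≤ n) :
    z ^ (k * (k + 1)) * qBinom q n k = (-1) ^ k := by
  induction k with
  | zero => simp
  | succ k ih =>
    have h₀ : 1 - q ^ (k + 1) ≠ 0 :=
      sub_ne_zero.mpr (hq.pow_ne_one_of_pos_of_lt (Nat.succ_ne_zero k) (by omega)).symm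
    have h₁ : qBinom q (n + 1) (k + 1) = 0 := by
      refine (mul_eq_zero.mp ?_).resolve_left h₀
      rw [one_sub_pow_mul_qBinom_succ_succ, hq.pow_eq_one, sub_self, zero_mul]
    rw [qBinom_succ_succ] at h₁
    have h₂ : z ^ ((k + 1) * (k + 1 + 1)) = z ^ (k * (k + 1)) * q ^ (k + 1) := by
      rw [← hz]
      ring
    rw [h₂]
    linear_combination z ^ (k * (k + 1)) * h₁ - ih (by omega)

end qBinom

lemma IsPrimitiveRoot.sum_pow_mul_succ {K : Type*} [Field K] {w : K} {m : ℕ}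
    (hw : IsPrimitiveRoot w (2 * m + 1)) :
    ∑ k ∈ range (2 * m + 1), w ^ (k * (k + 1)) =
      ∏ i ∈ range m, (1 - (w⁻¹ ^ 2) ^ (2 * i + 1)) := by
  have hq : IsPrimitiveRoot (w⁻¹ ^ 2) (2 * m + 1) :=
    hw.inv.pow_of_coprime 2 (by simp)
  rw [← sum_neg_one_pow_mul_qBinom_two_mul]
  refine sum_congr rfl fun k hk ↦ ?_
  have h := hq.pow_mul_qBinom rfl (Nat.lt_succ_iff.mp (mem_range.mp hk))
  have hw₀ : w ^ (k * (k + 1)) ≠ 0 := pow_ne_zero _ (hw.ne_zero (by omega))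
  rw [inv_pow, inv_mul_eq_iff_eq_mul₀ hw₀] at h
  rw [h, mul_left_comm, ← mul_pow]
  simp

lemma ZMod.sum_eq_sum_range {M : Type*} [AddCommMonoid M] (n : ℕ) [NeZero n] (f : ZMod n → M) :
    ∑ x : ZMod n, f x = ∑ k ∈ range n, f k := by
  refine sum_bij (fun x _ ↦ x.val) (fun x _ ↦ mem_range.mpr x.val_lt)
    (fun x _ y _ h ↦ ZMod.val_injective n h)
    (fun k hk ↦ ⟨k, mem_univ _, ZMod.val_natCast_of_lt (mem_range.mp hk)⟩) (fun x _ ↦ ?_)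
  rw [ZMod.natCast_zmod_val]

lemma mubOmega_eq_stdAddChar (d : ℕ) [NeZero d] (a : ZMod d) :
    mubOmega d a = ZMod.stdAddChar a := by
  rw [mubOmega, ZMod.stdAddChar_apply, ZMod.toCircle_apply]

lemma ZMod.isPrimitiveRoot_stdAddChar_one (d : ℕ) [NeZero d] :
    IsPrimitiveRoot (ZMod.stdAddChar (1 : ZMod d)) d := by
  have h := ZMod.stdAddChar_coe (N := d) 1
  simp only [Int.cast_one, mul_one] at h
  rw [h]
  exact Complex.isPrimitiveRoot_exp d (NeZero.ne d)

lemma sum_range_two_mul_add_one (m : ℕ) : ∑ i ∈ range m, (2 * i + 1) = m ^ 2 := by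
  induction m with
  | zero => rfl
  | succ m ih =>
    rw [sum_range_succ, ih]
    ring

/-- Gauss's product formula for the quadratic Gauss sum. -/
lemma sum_stdAddChar_sq_eq_prod (m : ℕ) :
    ∑ x : ZMod (2 * m + 1), ZMod.stdAddChar (x ^ 2) =
      ∏ i ∈ range m, (2 * I * Real.sin (2 * Real.pi * (2 * i + 1) / (2 * m + 1))) := by
  have hm : (2 * m + 1 : ZMod (2 * m + 1)) = 0 := by
    exact_mod_cast ZMod.natCast_self (2 * m + 1)
  have hpow (a : ℕ) : (ZMod.stdAddChar (a : ZMod (2 * m + 1)) : ℂ) =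
      ZMod.stdAddChar (1 : ZMod (2 * m + 1)) ^ a := by
    rw [← AddChar.map_nsmul_eq_pow, nsmul_one]
  have h₁ : ∑ x : ZMod (2 * m + 1), ZMod.stdAddChar (x ^ 2) =
      ZMod.stdAddChar ((m : ZMod (2 * m + 1)) ^ 2) *
        ∑ x : ZMod (2 * m + 1), (ZMod.stdAddChar (x * (x + 1)) : ℂ) := by
    rw [mul_sum, ← Equiv.sum_comp (Equiv.subRight (m : ZMod (2 * m + 1)))]
    refine sum_congr rfl fun x _ ↦ ?_
    rw [← AddChar.map_add_eq_mul, Equiv.subRight_apply]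
    congr 1
    linear_combination -x * hm
  have h₂ : ∑ x : ZMod (2 * m + 1), (ZMod.stdAddChar (x * (x + 1)) : ℂ) =
      ∏ i ∈ range m, (1 - ((ZMod.stdAddChar (1 : ZMod (2 * m + 1)))⁻¹ ^ 2) ^ (2 * i + 1)) := by
    rw [← (ZMod.isPrimitiveRoot_stdAddChar_one (2 * m + 1)).sum_pow_mul_succ,
      ZMod.sum_eq_sum_range]
    refine sum_congr rfl fun k _ ↦ ?_
    rw [← hpow]
    push_cast
    rfl
  have h₃ : (ZMod.stdAddChar ((m : ZMod (2 * m + 1)) ^ 2) : ℂ) =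
      ∏ i ∈ range m, ZMod.stdAddChar (1 : ZMod (2 * m + 1)) ^ (2 * i + 1) := by
    rw [prod_pow_eq_pow_sum, ← hpow, sum_range_two_mul_add_one, Nat.cast_pow]
  rw [h₁, h₂, h₃, ← prod_mul_distrib]
  refine prod_congr rfl fun i _ ↦ ?_
  have h₄ : (ZMod.stdAddChar (1 : ZMod (2 * m + 1)) : ℂ) ^ (2 * i + 1) =
      exp ((2 * Real.pi * (2 * i + 1) / (2 * m + 1) : ℂ) * I) := by
    have h := ZMod.stdAddChar_coe (N := 2 * m + 1) (2 * i + 1 : ℕ)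
    rw [← hpow]
    push_cast at h ⊢
    rw [h]
    congr 1
    ring
  rw [pow_right_comm, inv_pow, h₄, Complex.ofReal_sin, Complex.sin]
  push_cast
  set t : ℂ := 2 * Real.pi * (2 * i + 1) / (2 * m + 1)
  rw [neg_mul, exp_neg]
  have he := exp_ne_zero (t * I)
  field_simp
  linear_combination (exp (t * I) ^ 2 - 1) * I_sq

lemma exists_pos_prod_sin (m : ℕ) :
    ∃ r : ℝ, 0 < r ∧
      ∏ i ∈ range m, (2 * I * Real.sin (2 * Real.pi * (2 * i + 1) / (2 * m + 1))) =
        mubC (2 * m + 1) * r := by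
  obtain ⟨a, t, rfl, ha⟩ : ∃ a t, m = a + t ∧ (a = t ∨ a = t + 1) :=
    ⟨(m + 1) / 2, m / 2, by omega, by omega⟩
  set θ : ℕ → ℝ := fun i ↦ 2 * Real.pi * (2 * i + 1) / (2 * (a + t : ℕ) + 1) with hθ
  have hpi := Real.pi_pos
  have hpos (i : ℕ) (hi : i < a) : 0 < Real.sin (θ i) := by
    have hi' : (4 * i + 2 : ℝ) < 2 * (a + t : ℕ) + 1 := by
      exact_mod_cast (by omega : 4 * i + 2 < 2 * (a + t) + 1)
    refine Real.sin_pos_of_pos_of_lt_pi (by positivity) ?_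
    rw [hθ, div_lt_iff₀ (by positivity)]
    nlinarith
  have hneg (i : ℕ) (hi : i < t) : 0 < -Real.sin (θ (a + i)) := by
    have h₁ : (2 * (a + t : ℕ) + 1 : ℝ) < 4 * (a + i : ℕ) + 2 := by
      exact_mod_cast (by omega : 2 * (a + t) + 1 < 4 * (a + i) + 2)
    have h₂ : (4 * (a + i : ℕ) + 2 : ℝ) < 2 * (2 * (a + t : ℕ) + 1) := by
      exact_mod_cast (by omega : 4 * (a + i) + 2 < 2 * (2 * (a + t) + 1))
    rw [← Real.sin_sub_pi]
    refine Real.sin_pos_of_pos_of_lt_pi ?_ ?_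
    · rw [sub_pos, hθ, lt_div_iff₀ (by positivity)]
      nlinarith
    · rw [sub_lt_iff_lt_add, ← two_mul, hθ, div_lt_iff₀ (by positivity)]
      nlinarith
  refine ⟨2 ^ (a + t) * ((∏ i ∈ range a, Real.sin (θ i)) * ∏ i ∈ range t, -Real.sin (θ (a + i))),
    mul_pos (by positivity) (mul_pos (prod_pos fun i hi ↦ hpos i (mem_range.mp hi))
      (prod_pos fun i hi ↦ hneg i (mem_range.mp hi))), ?_⟩
  have hc : mubC (2 * (a + t) + 1) * (-1) ^ t = I ^ (a + t) := by
    rcases ha with rfl | rfl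
    · rw [mubC, if_pos (by omega), ← two_mul, pow_mul, I_sq, one_mul]
    · rw [mubC, if_neg (by omega), show t + 1 + t = 2 * t + 1 by ring, pow_succ, pow_mul, I_sq,
        mul_comm]
  simp only [prod_mul_distrib, prod_const, card_range, prod_neg]
  rw [← hc, prod_range_add]
  have hθ' (i : ℕ) : Real.sin (2 * Real.pi * (2 * i + 1) / (2 * (a + t : ℕ) + 1)) =
    Real.sin (θ i) := rfl
  simp only [← ofReal_prod, hθ', ofReal_mul, ofReal_pow, ofReal_neg, ofReal_one, ofReal_ofNat]
  ring

section quadraticGaussSum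

variable (d : ℕ) [Fact d.Prime]

lemma sum_addChar_mul_sq (hd : d ≠ 2) {a : ZMod d} (ha : a ≠ 0) {ψ : AddChar (ZMod d) ℂ}
    (hψ : ψ.IsPrimitive) :
    ∑ x, ψ (a * x ^ 2) = quadraticChar (ZMod d) a *
      gaussSum ((quadraticChar (ZMod d)).ringHomComp (Int.castRingHom ℂ)) ψ := by
  set χ := (quadraticChar (ZMod d)).ringHomComp (Int.castRingHom ℂ)
  have hF : ringChar (ZMod d) ≠ 2 := by rwa [ZMod.ringChar_zmod_n]
  have h₁ : ∑ x, ψ (a * x ^ 2) = ∑ y, (χ y + 1) * ψ (a * y) := by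
    rw [← sum_fiberwise' univ (fun x : ZMod d ↦ x ^ 2) (fun y ↦ ψ (a * y))]
    refine sum_congr rfl fun y _ ↦ ?_
    rw [sum_const, nsmul_eq_mul]
    congr 1
    have h := quadraticChar_card_sqrts hF y
    rw [Set.toFinset_ofPred] at h
    have h' := congrArg (Int.cast : ℤ → ℂ) h
    push_cast at h'
    exact h'
  have h₂ : ∑ y, ψ (a * y) = 0 := by
    simp only [mul_comm a]
    rw [AddChar.sum_mulShift a hψ, if_neg ha, Nat.cast_zero]
  have h₃ := gaussSum_mulShift χ ψ (Units.mk0 a ha)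
  have h₄ : (quadraticChar (ZMod d) a : ℂ) ^ 2 = 1 := by
    exact_mod_cast quadraticChar_sq_one ha
  have h₅ : χ a = (quadraticChar (ZMod d) a : ℂ) := rfl
  rw [Units.val_mk0, h₅] at h₃
  rw [h₁, ← h₃, ← mul_assoc, ← sq, h₄, one_mul]
  simp only [add_mul, one_mul, sum_add_distrib, h₂, add_zero]
  rfl

lemma norm_gaussSum_quadraticChar (hd : d ≠ 2) {ψ : AddChar (ZMod d) ℂ} (hψ : ψ.IsPrimitive) :
    ‖gaussSum ((quadraticChar (ZMod d)).ringHomComp (Int.castRingHom ℂ)) ψ‖ = √d := by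
  set χ := (quadraticChar (ZMod d)).ringHomComp (Int.castRingHom ℂ)
  have hF : ringChar (ZMod d) ≠ 2 := by rwa [ZMod.ringChar_zmod_n]
  have hχ₁ : χ ≠ 1 :=
    (MulChar.ringHomComp_ne_one_iff Int.cast_injective).mpr (quadraticChar_ne_one hF)
  have h := congrArg norm (gaussSum_sq hχ₁ ((quadraticChar_isQuadratic (ZMod d)).comp _) hψ)
  have h₁ : ‖χ (-1)‖ = 1 := by
    rw [← pow_eq_one_iff_of_nonneg (norm_nonneg _) two_ne_zero, ← norm_pow, ← map_pow]
    simp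
  rw [norm_pow, norm_mul, h₁, one_mul, ZMod.card, Complex.norm_natCast] at h
  rw [← h, Real.sqrt_sq (norm_nonneg _)]

lemma sum_stdAddChar_sq (hd : d ≠ 2) :
    ∑ x : ZMod d, ZMod.stdAddChar (x ^ 2) = mubC d * (√d : ℝ) := by
  have hG := sum_addChar_mul_sq d hd one_ne_zero (ZMod.isPrimitive_stdAddChar d)
  simp only [one_mul, map_one, Int.cast_one] at hG
  have hn := norm_gaussSum_quadraticChar d hd (ZMod.isPrimitive_stdAddChar d)
  rw [← hG] at hn
  obtain ⟨m, rfl⟩ := (Fact.out : d.Prime).odd_of_ne_two hd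
  obtain ⟨r, hr, h⟩ := exists_pos_prod_sin m
  rw [← sum_stdAddChar_sq_eq_prod] at h
  have hc : ‖mubC (2 * m + 1)‖ = 1 := by
    rw [mubC]
    split_ifs <;> simp
  rw [h, norm_mul, hc, one_mul, Complex.norm_real, Real.norm_of_nonneg hr.le] at hn
  rw [h, hn]

lemma sum_stdAddChar_mul_sq (hd : d ≠ 2) {a : ZMod d} (ha : a ≠ 0) :
    ∑ x : ZMod d, ZMod.stdAddChar (a * x ^ 2) =
      quadraticChar (ZMod d) a * (mubC d * (√d : ℝ)) := by
  have hG := sum_addChar_mul_sq d hd one_ne_zero (ZMod.isPrimitive_stdAddChar d)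
  simp only [one_mul, map_one, Int.cast_one] at hG
  rw [sum_addChar_mul_sq d hd ha (ZMod.isPrimitive_stdAddChar d), ← hG, sum_stdAddChar_sq d hd]

end quadraticGaussSum

lemma sum_mubPhi (d : ℕ) [Fact d.Prime] (hd : d ≠ 2) (j ℓ : ZMod d) :
    ∑ k, mubPhi d j k ℓ = mubC d * ZMod.stdAddChar ((j - 2⁻¹ ^ 2) * ℓ ^ 2) := by
  have h₂ : (2 : ZMod d) ≠ 0 := Ring.two_ne_zero (by rwa [ZMod.ringChar_zmod_n])
  have hd₀ : ((√d : ℝ) : ℂ) ≠ 0 := by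
    simpa using (Fact.out : d.Prime).ne_zero
  have h (k : ZMod d) : mubPhi d j k ℓ = 1 / (√d : ℝ) *
      ZMod.stdAddChar ((j - 2⁻¹ ^ 2) * ℓ ^ 2) * ZMod.stdAddChar ((k - 2⁻¹ * ℓ) ^ 2) := by
    rw [mubPhi, mubOmega_eq_stdAddChar, mul_assoc, ← AddChar.map_add_eq_mul]
    congr 2
    linear_combination k * ℓ * mul_inv_cancel₀ h₂
  simp only [h]
  have hs : ∑ k, (ZMod.stdAddChar ((k - 2⁻¹ * ℓ) ^ 2) : ℂ) =
      ∑ k : ZMod d, ZMod.stdAddChar (k ^ 2) :=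
    Equiv.sum_comp (Equiv.subRight (2⁻¹ * ℓ)) fun k ↦ (ZMod.stdAddChar (k ^ 2) : ℂ)
  rw [← mul_sum, hs, sum_stdAddChar_sq d hd]
  field_simp

lemma conj_mubC_mul_mubC (d : ℕ) : (starRingEnd ℂ) (mubC d) * mubC d = 1 := by
  rw [mubC]
  split_ifs <;> simp

lemma mubS_eq_sum (d : ℕ) [NeZero d] [Fact d.Prime] (hd : d ≠ 2) (j j' : ZMod d) :
    mubS d j j' = ∑ ℓ : ZMod d, ZMod.stdAddChar ((j' - j) * ℓ ^ 2) := by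
  have h : mubS d j j' = ∑ ℓ, (starRingEnd ℂ) (∑ k, mubPhi d j k ℓ) * ∑ k, mubPhi d j' k ℓ := by
    simp only [mubS, mubInner, map_sum, sum_mul_sum]
    rw [sum_comm_cycle, sum_comm_cycle]
  rw [h]
  refine sum_congr rfl fun ℓ _ ↦ ?_
  rw [sum_mubPhi d hd, sum_mubPhi d hd, map_mul, mul_mul_mul_comm, conj_mubC_mul_mubC, one_mul,
    ← AddChar.map_neg_eq_conj, ← AddChar.map_add_eq_mul]
  congr 1
  ring

/-- The sums `S^{(j,j')} = Σ_{k,k'} ⟨φ_k^{(j)}, φ_{k'}^{(j')}⟩` satisfy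
`S^{(j,j)} = d`, and `S^{(j,j')} = c_d·√d·((j'−j)|d)` for `j ≠ j'`. -/
theorem stmt_14 (d : ℕ) [NeZero d] [Fact d.Prime] (hodd : Odd d) (j j' : ZMod d) :
    (j = j' → mubS d j j' = (d : ℂ)) ∧
    (j ≠ j' →
      mubS d j j' = mubC d * (Real.sqrt d : ℂ) * (legendreSym d ((j' - j).val : ℤ) : ℂ)) := by
  have hd : d ≠ 2 := by
    rintro rfl
    exact absurd hodd (by decide)
  rw [mubS_eq_sum d hd]
  refine ⟨?_, fun h ↦ ?_⟩
  · rintro rfl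
    simp
  · rw [sum_stdAddChar_mul_sq d hd (sub_ne_zero.mpr h.symm), legendreSym, mul_comm]
    simp
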